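/- Let μ, ν ∈ P₁((0,∞)) with μ ≤_c ν. Call the pair (μ,ν) irreducible if for all Borel sets A, B ⊆ (0,∞) with μ(A) > 0 and ν(B) > 0 there exists π ∈ M(μ,ν) with π(A × B) > 0. Then (μ,ν) is irreducible if and only if (S(μ), S(ν)) is irreducible. -/

import Mathlib

open MeasureTheory Set

/-- Barycenter of a measure on `ℝ`. -/
noncomputable def bary (mu : Measure ℝ) : ℝ := ∫ x, x ∂mu

/-- `mu ∈ P₁((0,∞))`: Borel probability measure on `ℝ` concentrated on `(0,∞)`
with finite first moment. -/
def MemP1 (mu : Measure ℝ) : Prop :=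
  IsProbabilityMeasure mu ∧ mu (Set.Ioi (0:ℝ))ᶜ = 0 ∧ Integrable id mu

/-- Change-of-numeraire transform of a measure on `ℝ`:
`S(mu)(B) = (1/b(mu)) ∫ x · 1_B(1/x) dmu(x)`. -/
noncomputable def S (mu : Measure ℝ) : Measure ℝ :=
  (ENNReal.ofReal (bary mu))⁻¹ •
    ((mu.withDensity fun x => ENNReal.ofReal x).map fun x => x⁻¹)

/-- Change-of-numeraire transform of a measure on `ℝ × ℝ`:
`S(π)(B) = (∫ x₁ · 1_B(1/x₀,1/x₁) dπ) / (∫ x₁ dπ)`. -/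
noncomputable def S2 (pi : Measure (ℝ × ℝ)) : Measure (ℝ × ℝ) :=
  (ENNReal.ofReal (∫ p, p.2 ∂pi))⁻¹ •
    ((pi.withDensity fun p => ENNReal.ofReal p.2).map fun p => (p.1⁻¹, p.2⁻¹))

/-- `π ∈ M(μ,ν)`: martingale coupling of `μ` and `ν`, i.e. a probability measure on
`(0,∞)²` with first marginal `μ`, second marginal `ν`, such that
`∫ f(x₀)(x₁ - x₀) dπ = 0` for all bounded Borel `f`. -/
def IsMC (mu nu : Measure ℝ) (pi : Measure (ℝ × ℝ)) : Prop :=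
  IsProbabilityMeasure pi ∧
  pi ((Set.Ioi (0:ℝ) ×ˢ Set.Ioi (0:ℝ))ᶜ) = 0 ∧
  pi.map Prod.fst = mu ∧ pi.map Prod.snd = nu ∧
  ∀ f : ℝ → ℝ, Measurable f → (∃ M, ∀ x, |f x| ≤ M) →
    ∫ p, f p.1 * (p.2 - p.1) ∂pi = 0


/-- Convex order: `∫ φ dμ ≤ ∫ φ dν` for every convex `φ` for which both integrals exist. -/
def ConvexOrder (mu nu : Measure ℝ) : Prop :=
  ∀ phi : ℝ → ℝ, ConvexOn ℝ Set.univ phi → Integrable phi mu → Integrable phi nu →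
    ∫ x, phi x ∂mu ≤ ∫ x, phi x ∂nu

/-- The pair `(μ,ν)` is irreducible: every pair of Borel sets `A, B ⊆ (0,∞)` charged by
`μ` resp. `ν` is charged by some martingale coupling. -/
def IrreduciblePair (mu nu : Measure ℝ) : Prop :=
  ∀ A B : Set ℝ, MeasurableSet A → MeasurableSet B →
    A ⊆ Set.Ioi (0:ℝ) → B ⊆ Set.Ioi (0:ℝ) → 0 < mu A → 0 < nu B →
    ∃ pi, IsMC mu nu pi ∧ 0 < pi (A ×ˢ B)

section WeightedMap

variable {α β : Type*} [MeasurableSpace α] [MeasurableSpace β]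

/-- Lebesgue integral against a scaled, reweighted and pushed forward measure. -/
lemma lintegral_smul_map_withDensity (m : Measure α) (c : ENNReal) {w : α → ENNReal}
    (hw : Measurable w) {φ : α → β} (hφ : Measurable φ) {g : β → ENNReal} (hg : Measurable g) :
    ∫⁻ y, g y ∂(c • (m.withDensity w).map φ) = c * ∫⁻ x, w x * g (φ x) ∂m := by
  rw [lintegral_smul_measure, lintegral_map hg hφ, smul_eq_mul]
  exact congrArg (c * ·) (lintegral_withDensity_eq_lintegral_mul m hw (hg.comp hφ))

/-- Bochner integral against a scaled, reweighted and pushed forward measure. -/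
lemma integral_smul_map_withDensity (m : Measure α) (c : ENNReal) {w : α → ℝ}
    (hw : Measurable w) (hpos : ∀ᵐ x ∂m, 0 < w x) {φ : α → β} (hφ : Measurable φ)
    {g : β → ℝ} (hg : Measurable g) :
    ∫ y, g y ∂(c • (m.withDensity fun x => ENNReal.ofReal (w x)).map φ)
      = c.toReal * ∫ x, w x * g (φ x) ∂m := by
  rw [integral_smul_measure, integral_map hφ.aemeasurable hg.aestronglyMeasurable,
    integral_withDensity_eq_integral_toReal_smul hw.ennreal_ofReal
      (Filter.Eventually.of_forall fun _ => ENNReal.ofReal_lt_top)]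
  rw [smul_eq_mul]
  congr 1
  refine integral_congr_ae ?_
  filter_upwards [hpos] with x hx
  rw [ENNReal.toReal_ofReal hx.le, smul_eq_mul]

end WeightedMap

lemma MemP1.ae_pos {mu : Measure ℝ} (h : MemP1 mu) : ∀ᵐ x ∂mu, 0 < x :=
  mem_ae_iff.2 h.2.1

lemma MemP1.bary_pos {mu : Measure ℝ} (h : MemP1 mu) : 0 < bary mu := by
  have := h.1
  unfold bary
  rw [integral_pos_iff_support_of_nonneg_ae (h.ae_pos.mono fun _ hx => hx.le) h.2.2,
    show mu (Function.support fun x : ℝ => x) = 1 from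
      (prob_compl_eq_zero_iff (measurableSet_support measurable_id)).1
        (mem_ae_iff.1 (h.ae_pos.mono fun _ hx => hx.ne'))]
  exact one_pos

lemma MemP1.lintegral_ofReal {mu : Measure ℝ} (h : MemP1 mu) :
    ∫⁻ x, ENNReal.ofReal x ∂mu = ENNReal.ofReal (bary mu) :=
  (ofReal_integral_eq_lintegral_ofReal h.2.2 (h.ae_pos.mono fun _ hx => hx.le)).symm

lemma MemP1.inv_mul_ofReal_bary {mu : Measure ℝ} (h : MemP1 mu) :
    (ENNReal.ofReal (bary mu))⁻¹ * ENNReal.ofReal (bary mu) = 1 :=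
  ENNReal.inv_mul_cancel (ENNReal.ofReal_pos.2 h.bary_pos).ne' ENNReal.ofReal_ne_top

lemma lintegral_S (mu : Measure ℝ) {g : ℝ → ENNReal} (hg : Measurable g) :
    ∫⁻ y, g y ∂(S mu)
      = (ENNReal.ofReal (bary mu))⁻¹ * ∫⁻ x, ENNReal.ofReal x * g x⁻¹ ∂mu :=
  lintegral_smul_map_withDensity mu _ ENNReal.measurable_ofReal measurable_inv hg

lemma MemP1.integral_S {mu : Measure ℝ} (h : MemP1 mu) {g : ℝ → ℝ} (hg : Measurable g) :
    ∫ y, g y ∂(S mu) = (bary mu)⁻¹ * ∫ x, x * g x⁻¹ ∂mu := by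
  have := integral_smul_map_withDensity mu (ENNReal.ofReal (bary mu))⁻¹ measurable_id
    h.ae_pos measurable_inv hg
  rwa [ENNReal.toReal_inv, ENNReal.toReal_ofReal h.bary_pos.le] at this

lemma S_apply (mu : Measure ℝ) {B : Set ℝ} (hB : MeasurableSet B) :
    S mu B = (ENNReal.ofReal (bary mu))⁻¹ *
      ∫⁻ x in (fun x => x⁻¹) ⁻¹' B, ENNReal.ofReal x ∂mu := by
  rw [S, Measure.smul_apply, Measure.map_apply measurable_inv hB,
    withDensity_apply _ (measurable_inv hB), smul_eq_mul]

lemma S_absolutelyContinuous (mu : Measure ℝ) : S mu ≪ mu.map fun x => x⁻¹ :=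
  Measure.AbsolutelyContinuous.smul_left
    ((withDensity_absolutelyContinuous _ _).map measurable_inv) _

lemma MemP1.lintegral_S_ofReal {mu : Measure ℝ} (h : MemP1 mu) :
    ∫⁻ y, ENNReal.ofReal y ∂(S mu) = (ENNReal.ofReal (bary mu))⁻¹ := by
  have := h.1
  rw [lintegral_S mu ENNReal.measurable_ofReal]
  have : ∫⁻ x, ENNReal.ofReal x * ENNReal.ofReal x⁻¹ ∂mu = ∫⁻ _, 1 ∂mu := by
    refine lintegral_congr_ae ?_
    filter_upwards [h.ae_pos] with x hx
    rw [← ENNReal.ofReal_mul hx.le, mul_inv_cancel₀ hx.ne', ENNReal.ofReal_one]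
  simp [this]

lemma MemP1.memP1_S {mu : Measure ℝ} (h : MemP1 mu) : MemP1 (S mu) := by
  have hnull : S mu (Set.Ioi (0:ℝ))ᶜ = 0 := by
    refine S_absolutelyContinuous mu ?_
    rw [Measure.map_apply measurable_inv measurableSet_Ioi.compl]
    refine measure_mono_null (fun x hx => ?_) h.2.1
    simpa using hx
  refine ⟨⟨?_⟩, hnull, measurable_id.aestronglyMeasurable, ?_⟩
  · rw [S_apply mu MeasurableSet.univ, preimage_univ, Measure.restrict_univ,
      h.lintegral_ofReal, h.inv_mul_ofReal_bary]
  · have hpos : ∀ᵐ y ∂(S mu), y ∈ Set.Ioi (0:ℝ) := mem_ae_iff.2 hnull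
    rw [hasFiniteIntegral_iff_ofReal (f := id) (hpos.mono fun _ hy => le_of_lt hy)]
    simpa only [id, h.lintegral_S_ofReal, ENNReal.inv_lt_top, ENNReal.ofReal_pos] using h.bary_pos

lemma MemP1.S_S {mu : Measure ℝ} (h : MemP1 mu) : S (S mu) = mu := by
  ext B hB
  have hb : ENNReal.ofReal (bary (S mu)) = (ENNReal.ofReal (bary mu))⁻¹ := by
    rw [← h.memP1_S.lintegral_ofReal, h.lintegral_S_ofReal]
  have hm : MeasurableSet ((fun x : ℝ => x⁻¹) ⁻¹' B) := measurable_inv hB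
  rw [S_apply _ hB, hb, ← lintegral_indicator hm,
    lintegral_S mu (ENNReal.measurable_ofReal.indicator hm), ← mul_assoc, inv_inv, mul_comm
    (ENNReal.ofReal (bary mu)), h.inv_mul_ofReal_bary, one_mul, ← lintegral_indicator_one hB]
  refine lintegral_congr_ae ?_
  filter_upwards [h.ae_pos] with x hx
  by_cases hxB : x ∈ B
  · rw [indicator_of_mem (by simpa using hxB), indicator_of_mem hxB, ← ENNReal.ofReal_mul hx.le,
      mul_inv_cancel₀ hx.ne', ENNReal.ofReal_one, Pi.one_apply]
  · rw [indicator_of_notMem (by simpa using hxB), indicator_of_notMem hxB, mul_zero]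

section Coupling

variable {mu nu : Measure ℝ} {pi : Measure (ℝ × ℝ)}

lemma IsMC.ae_pos (hpi : IsMC mu nu pi) : ∀ᵐ p ∂pi, 0 < p.1 ∧ 0 < p.2 :=
  mem_ae_iff.2 hpi.2.1

lemma IsMC.integrable_fst (hpi : IsMC mu nu pi) (hmu : MemP1 mu) :
    Integrable (fun p : ℝ × ℝ => p.1) pi := by
  have := hmu.2.2
  rw [← hpi.2.2.1] at this
  exact this.comp_measurable measurable_fst

lemma IsMC.integrable_snd (hpi : IsMC mu nu pi) (hnu : MemP1 nu) :
    Integrable (fun p : ℝ × ℝ => p.2) pi := by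
  have := hnu.2.2
  rw [← hpi.2.2.2.1] at this
  exact this.comp_measurable measurable_snd

lemma IsMC.integral_fst (hpi : IsMC mu nu pi) {g : ℝ → ℝ} (hg : Measurable g) :
    ∫ p, g p.1 ∂pi = ∫ x, g x ∂mu := by
  rw [← hpi.2.2.1, integral_map measurable_fst.aemeasurable hg.aestronglyMeasurable]

lemma IsMC.integral_snd (hpi : IsMC mu nu pi) {g : ℝ → ℝ} (hg : Measurable g) :
    ∫ p, g p.2 ∂pi = ∫ x, g x ∂nu := by
  rw [← hpi.2.2.2.1, integral_map measurable_snd.aemeasurable hg.aestronglyMeasurable]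

lemma IsMC.setIntegral_eq (hpi : IsMC mu nu pi) (hmu : MemP1 mu) (hnu : MemP1 nu) {A : Set ℝ}
    (hA : MeasurableSet A) :
    ∫ p in Prod.fst ⁻¹' A, p.2 ∂pi = ∫ p in Prod.fst ⁻¹' A, p.1 ∂pi := by
  have h := hpi.2.2.2.2 (A.indicator 1) (measurable_one.indicator hA)
    ⟨1, fun x => by by_cases hx : x ∈ A <;> simp [hx]⟩
  rw [← sub_eq_zero, ← integral_sub (hpi.integrable_snd hnu).integrableOn
    (hpi.integrable_fst hmu).integrableOn, ← integral_indicator (measurable_fst hA), ← h]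
  congr 1
  ext p
  by_cases hp : p.1 ∈ A <;> simp [hp]

lemma IsMC.setLIntegral_eq (hpi : IsMC mu nu pi) (hmu : MemP1 mu) (hnu : MemP1 nu) {A : Set ℝ}
    (hA : MeasurableSet A) :
    ∫⁻ p in Prod.fst ⁻¹' A, ENNReal.ofReal p.2 ∂pi = ∫⁻ x in A, ENNReal.ofReal x ∂mu := by
  rw [← ofReal_integral_eq_lintegral_ofReal (hpi.integrable_snd hnu).integrableOn
      (ae_restrict_of_ae (hpi.ae_pos.mono fun _ hp => hp.2.le)),
    hpi.setIntegral_eq hmu hnu hA,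
    ofReal_integral_eq_lintegral_ofReal (hpi.integrable_fst hmu).integrableOn
      (ae_restrict_of_ae (hpi.ae_pos.mono fun _ hp => hp.1.le)),
    ← hpi.2.2.1, setLIntegral_map hA ENNReal.measurable_ofReal measurable_fst]

lemma IsMC.bary_eq (hpi : IsMC mu nu pi) (hmu : MemP1 mu) (hnu : MemP1 nu) :
    bary mu = bary nu := by
  have h := hpi.setIntegral_eq hmu hnu MeasurableSet.univ
  simp only [preimage_univ, Measure.restrict_univ] at h
  exact ((hpi.integral_snd measurable_id).symm.trans
    (h.trans (hpi.integral_fst measurable_id))).symm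

lemma measurable_inv_prod : Measurable fun p : ℝ × ℝ => (p.1⁻¹, p.2⁻¹) := by fun_prop

lemma S2_apply (pi : Measure (ℝ × ℝ)) {C : Set (ℝ × ℝ)} (hC : MeasurableSet C) :
    S2 pi C = (ENNReal.ofReal (∫ p, p.2 ∂pi))⁻¹ *
      ∫⁻ p in (fun p : ℝ × ℝ => (p.1⁻¹, p.2⁻¹)) ⁻¹' C, ENNReal.ofReal p.2 ∂pi := by
  rw [S2, Measure.smul_apply, Measure.map_apply measurable_inv_prod hC,
    withDensity_apply _ (measurable_inv_prod hC), smul_eq_mul]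

/-- The change of numeraire maps martingale couplings to martingale couplings. -/
lemma IsMC.isMC_S2 (hpi : IsMC mu nu pi) (hmu : MemP1 mu) (hnu : MemP1 nu) :
    IsMC (S mu) (S nu) (S2 pi) := by
  have hb : ∫ p, p.2 ∂pi = bary nu := hpi.integral_snd measurable_id
  have hfst : (S2 pi).map Prod.fst = S mu := by
    ext B hB
    rw [Measure.map_apply measurable_fst hB, S2_apply _ (measurable_fst hB), S_apply _ hB, hb,
      hpi.bary_eq hmu hnu, ← hpi.setLIntegral_eq hmu hnu (measurable_inv hB)]
    rfl
  have hsnd : (S2 pi).map Prod.snd = S nu := by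
    ext B hB
    rw [Measure.map_apply measurable_snd hB, S2_apply _ (measurable_snd hB), S_apply _ hB, hb,
      ← hpi.2.2.2.1, setLIntegral_map (measurable_inv hB) ENNReal.measurable_ofReal
      measurable_snd]
    rfl
  have hprob : IsProbabilityMeasure (S2 pi) := by
    refine ⟨?_⟩
    have h := hmu.memP1_S.1.measure_univ
    rwa [← hfst, Measure.map_apply measurable_fst MeasurableSet.univ, preimage_univ] at h
  have hint1 : Integrable (fun p : ℝ × ℝ => p.1) (S2 pi) := by
    have h := hmu.memP1_S.2.2
    rw [← hfst] at h
    exact h.comp_measurable measurable_fst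
  have hint2 : Integrable (fun p : ℝ × ℝ => p.2) (S2 pi) := by
    have h := hnu.memP1_S.2.2
    rw [← hsnd] at h
    exact h.comp_measurable measurable_snd
  refine ⟨hprob, ?_, hfst, hsnd, ?_⟩
  · have hm : MeasurableSet ((Set.Ioi (0:ℝ) ×ˢ Set.Ioi (0:ℝ))ᶜ) :=
      (measurableSet_Ioi.prod measurableSet_Ioi).compl
    have hnull : pi ((fun p : ℝ × ℝ => (p.1⁻¹, p.2⁻¹)) ⁻¹'
        (Set.Ioi (0:ℝ) ×ˢ Set.Ioi (0:ℝ))ᶜ) = 0 := by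
      refine measure_mono_null (fun p hp => ?_) hpi.2.1
      simpa using hp
    rw [S2_apply _ hm, setLIntegral_measure_zero _ _ hnull, mul_zero]
  · rintro f hf ⟨M, hM⟩
    have hbdd : ∀ᵐ p ∂(S2 pi), ‖f p.1‖ ≤ M := Filter.Eventually.of_forall fun p => hM p.1
    have hf1 : AEStronglyMeasurable (fun p : ℝ × ℝ => f p.1) (S2 pi) :=
      (hf.comp measurable_fst).aestronglyMeasurable
    simp only [mul_sub]
    rw [integral_sub (hint2.bdd_mul hf1 hbdd) (hint1.bdd_mul hf1 hbdd), sub_eq_zero]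
    have hm1 : Measurable fun x => f x * x := hf.mul measurable_id
    have h1 : ∫ p, f p.1 * p.1 ∂(S2 pi) = (bary mu)⁻¹ * ∫ x, f x⁻¹ ∂mu := by
      rw [show ∫ p, f p.1 * p.1 ∂(S2 pi) = ∫ x, f x * x ∂(S mu) by
        rw [← hfst, integral_map measurable_fst.aemeasurable hm1.aestronglyMeasurable],
        hmu.integral_S hm1]
      congr 1
      refine integral_congr_ae ?_
      filter_upwards [hmu.ae_pos] with x hx
      field_simp
    have h2 : ∫ p, f p.1 * p.2 ∂(S2 pi) = (bary nu)⁻¹ * ∫ p, f p.1⁻¹ ∂pi := by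
      have h := integral_smul_map_withDensity pi (ENNReal.ofReal (∫ p, p.2 ∂pi))⁻¹
        measurable_snd (hpi.ae_pos.mono fun _ hp => hp.2) measurable_inv_prod
        ((hf.comp measurable_fst).mul measurable_snd)
      refine h.trans ?_
      rw [hb, ENNReal.toReal_inv, ENNReal.toReal_ofReal hnu.bary_pos.le]
      congr 1
      refine integral_congr_ae ?_
      filter_upwards [hpi.ae_pos] with p hp
      have := hp.2.ne'
      simp only [Pi.mul_apply, Function.comp_apply]
      field_simp
    rw [h1, h2, hpi.bary_eq hmu hnu,
      hpi.integral_fst (g := fun x => f x⁻¹) (hf.comp measurable_inv)]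

lemma IsMC.S2_pos (hpi : IsMC mu nu pi) {C : Set (ℝ × ℝ)} (hC : MeasurableSet C)
    (hpos : 0 < pi ((fun p : ℝ × ℝ => (p.1⁻¹, p.2⁻¹)) ⁻¹' C)) : 0 < S2 pi C := by
  rw [S2_apply _ hC]
  refine ENNReal.mul_pos (ENNReal.inv_ne_zero.2 ENNReal.ofReal_ne_top) fun h => hpos.ne' ?_
  rw [lintegral_eq_zero_iff (by fun_prop), Filter.EventuallyEq,
    ae_restrict_iff' (measurable_inv_prod hC)] at h
  refine measure_eq_zero_iff_ae_notMem.2 ?_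
  filter_upwards [h, hpi.ae_pos] with p hp hp' hmem
  exact (ENNReal.ofReal_pos.2 hp'.2).ne' (hp hmem)

end Coupling

/-- Irreducibility is preserved by the change of numeraire. -/
lemma IrreduciblePair.irreduciblePair_S {mu nu : Measure ℝ} (h : IrreduciblePair mu nu)
    (hmu : MemP1 mu) (hnu : MemP1 nu) : IrreduciblePair (S mu) (S nu) := by
  have key {m : Measure ℝ} {A : Set ℝ} (hA : MeasurableSet A) (hpos : 0 < S m A) :
      0 < m ((fun x => x⁻¹) ⁻¹' A) := by
    refine pos_iff_ne_zero.2 fun h0 => hpos.ne' (S_absolutelyContinuous m ?_)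
    rwa [Measure.map_apply measurable_inv hA]
  intro A B hA hB hA0 hB0 hAp hBp
  obtain ⟨pi, hpi, hp⟩ := h _ _ (measurable_inv hA) (measurable_inv hB)
    (fun x hx => mem_Ioi.2 (inv_pos.1 (hA0 hx))) (fun x hx => mem_Ioi.2 (inv_pos.1 (hB0 hx))) (key hA hAp) (key hB hBp)
  exact ⟨S2 pi, hpi.isMC_S2 hmu hnu, hpi.S2_pos (hA.prod hB) hp⟩

/-- `(μ,ν)` is irreducible iff `(S(μ),S(ν))` is irreducible. -/
theorem stmt10 (mu nu : Measure ℝ) (hmu : MemP1 mu) (hnu : MemP1 nu)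
    (hcvx : ConvexOrder mu nu) :
    IrreduciblePair mu nu ↔ IrreduciblePair (S mu) (S nu) := by
  refine ⟨fun h => h.irreduciblePair_S hmu hnu, fun h => ?_⟩
  have := h.irreduciblePair_S hmu.memP1_S hnu.memP1_S
  rwa [hmu.S_S, hnu.S_S] at this
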